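/- Let (f,g,ρ) be a warped Berger solution of Ricci flow on S^1×S^3 defined on [0,T) such that at t = 0 one has f ≤ g and (min_ξ R(ξ,0))·(max_ξ g(ξ,0)²) > −3. If T < ∞ and liminf_{t↗T} M̌(t) = 0, then there exists a constant c > 0 such that M̌(t)² ≥ c(T − t) for all t ∈ [0,T). -/

import Mathlib

open Real Set Filter Topology

noncomputable section

/-- Partial derivative in the first (spatial, `ξ`) variable. -/
def pd1 (φ : ℝ → ℝ → ℝ) (ξ t : ℝ) : ℝ := deriv (fun x => φ x t) ξ

/-- Partial derivative in the second (time) variable: `φ_t`. -/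
def pdt (φ : ℝ → ℝ → ℝ) (ξ t : ℝ) : ℝ := deriv (fun τ => φ ξ τ) t

/-- Derivative with respect to arclength `s` (where `ds = ρ dξ`): `φ_s := ρ⁻¹ ∂_ξ φ`. -/
def Ds (ρ φ : ℝ → ℝ → ℝ) (ξ t : ℝ) : ℝ := pd1 φ ξ t / ρ ξ t

/-- Sectional curvature `κ₁₂ = κ₃₁ = f²/g⁴ − f_s g_s/(f g)`. -/
def k12 (ρ f g : ℝ → ℝ → ℝ) (ξ t : ℝ) : ℝ :=
  (f ξ t) ^ 2 / (g ξ t) ^ 4 - Ds ρ f ξ t * Ds ρ g ξ t / (f ξ t * g ξ t)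

/-- Sectional curvature `κ₃₁ = κ₁₂`. -/
def k31 (ρ f g : ℝ → ℝ → ℝ) (ξ t : ℝ) : ℝ :=
  (f ξ t) ^ 2 / (g ξ t) ^ 4 - Ds ρ f ξ t * Ds ρ g ξ t / (f ξ t * g ξ t)

/-- Sectional curvature `κ₂₃ = (4g² − 3f²)/g⁴ − g_s²/g²`. -/
def k23 (ρ f g : ℝ → ℝ → ℝ) (ξ t : ℝ) : ℝ :=
  (4 * (g ξ t) ^ 2 - 3 * (f ξ t) ^ 2) / (g ξ t) ^ 4 - (Ds ρ g ξ t) ^ 2 / (g ξ t) ^ 2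

/-- Sectional curvature `κ₀₁ = −f_ss/f`. -/
def k01 (ρ f : ℝ → ℝ → ℝ) (ξ t : ℝ) : ℝ := -(Ds ρ (Ds ρ f) ξ t) / f ξ t

/-- Sectional curvature `κ₀₂ = κ₀₃ = −g_ss/g`. -/
def k02 (ρ g : ℝ → ℝ → ℝ) (ξ t : ℝ) : ℝ := -(Ds ρ (Ds ρ g) ξ t) / g ξ t

/-- Scalar curvature `R = κ₀₁ + 2κ₀₂ + 2κ₁₂ + κ₂₃`. -/
def scalR (ρ f g : ℝ → ℝ → ℝ) (ξ t : ℝ) : ℝ :=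
  k01 ρ f ξ t + 2 * k02 ρ g ξ t + 2 * k12 ρ f g ξ t + k23 ρ f g ξ t

/-- `M(ξ,t) := min {f(ξ,t), g(ξ,t)}`. -/
def M (f g : ℝ → ℝ → ℝ) (ξ t : ℝ) : ℝ := min (f ξ t) (g ξ t)

/-- `M̌(t) := min_{ξ ∈ S¹} M(ξ,t)`. -/
def Mcheck (f g : ℝ → ℝ → ℝ) (t : ℝ) : ℝ := ⨅ ξ : ℝ, M f g ξ t

/-- A warped Berger solution of Ricci flow on `S¹ × S³` with (finite) existence time `T`:
smooth positive `2π`-periodic-in-`ξ` functions `f, g, ρ` on `S¹ × [0,T)` satisfying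
  `f_t = f_ss + 2 (g_s/g) f_s − 2 f³/g⁴`,
  `g_t = g_ss + (f_s/f + g_s/g) g_s + 2 (f² − 2g²)/g³`,
  `(log ρ)_t = f_ss/f + 2 g_ss/g`. -/
structure WarpedBerger (T : ℝ) (f g ρ : ℝ → ℝ → ℝ) : Prop where
  T_pos : 0 < T
  f_pos : ∀ ξ t : ℝ, 0 ≤ t → t < T → 0 < f ξ t
  g_pos : ∀ ξ t : ℝ, 0 ≤ t → t < T → 0 < g ξ t
  ρ_pos : ∀ ξ t : ℝ, 0 ≤ t → t < T → 0 < ρ ξ t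
  f_per : ∀ ξ t : ℝ, f (ξ + 2 * π) t = f ξ t
  g_per : ∀ ξ t : ℝ, g (ξ + 2 * π) t = g ξ t
  ρ_per : ∀ ξ t : ℝ, ρ (ξ + 2 * π) t = ρ ξ t
  smooth : ContDiffOn ℝ (⊤ : ℕ∞)
      (fun p : ℝ × ℝ => (f p.1 p.2, g p.1 p.2, ρ p.1 p.2)) (Set.univ ×ˢ Set.Ico 0 T)
  eq_f : ∀ ξ t : ℝ, 0 < t → t < T →
    pdt f ξ t = Ds ρ (Ds ρ f) ξ t + 2 * (Ds ρ g ξ t / g ξ t) * Ds ρ f ξ t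
      - 2 * (f ξ t) ^ 3 / (g ξ t) ^ 4
  eq_g : ∀ ξ t : ℝ, 0 < t → t < T →
    pdt g ξ t = Ds ρ (Ds ρ g) ξ t
      + (Ds ρ f ξ t / f ξ t + Ds ρ g ξ t / g ξ t) * Ds ρ g ξ t
      + 2 * ((f ξ t) ^ 2 - 2 * (g ξ t) ^ 2) / (g ξ t) ^ 3
  eq_ρ : ∀ ξ t : ℝ, 0 < t → t < T →
    pdt (fun x τ => Real.log (ρ x τ)) ξ t
      = Ds ρ (Ds ρ f) ξ t / f ξ t + 2 * (Ds ρ (Ds ρ g) ξ t / g ξ t)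

/-- Smoothness on the strip over the time interval `I`. -/
def Sm (I : Set ℝ) (φ : ℝ → ℝ → ℝ) : Prop :=
  ContDiffOn ℝ (⊤ : ℕ∞) (fun p : ℝ × ℝ => φ p.1 p.2) (Set.univ ×ˢ I)

theorem Sm.mono {I J : Set ℝ} {φ : ℝ → ℝ → ℝ} (h : Sm I φ) (hJ : J ⊆ I) : Sm J φ :=
  ContDiffOn.mono h (Set.prod_mono le_rfl hJ)

theorem Sm.congr {I : Set ℝ} {φ ψ : ℝ → ℝ → ℝ} (h : Sm I φ)
    (hc : ∀ x, ∀ t ∈ I, ψ x t = φ x t) : Sm I ψ :=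
  ContDiffOn.congr h (fun p hp => hc p.1 p.2 hp.2)

theorem Sm.slice {I : Set ℝ} {φ : ℝ → ℝ → ℝ} (h : Sm I φ) {t : ℝ} (ht : t ∈ I) :
    ContDiff ℝ (⊤ : ℕ∞) (fun x => φ x t) := by
  have h2 : ContDiff ℝ (⊤ : ℕ∞) (fun x : ℝ => ((x, t) : ℝ × ℝ)) := by fun_prop
  exact ContDiffOn.comp_contDiff h h2 (fun x => ⟨trivial, ht⟩)

theorem Sm.hasDeriv {I : Set ℝ} {φ : ℝ → ℝ → ℝ} (h : Sm I φ) {t : ℝ} (ht : t ∈ I) (ξ : ℝ) :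
    HasDerivAt (fun x => φ x t) (pd1 φ ξ t) ξ :=
  (((h.slice ht).differentiable (by simp)) ξ).hasDerivAt

theorem pd1_eq {I : Set ℝ} {φ : ℝ → ℝ → ℝ} (h : Sm I φ) {t : ℝ} (ht : t ∈ I) (ξ : ℝ) :
    pd1 φ ξ t = fderivWithin ℝ (fun p : ℝ × ℝ => φ p.1 p.2) (Set.univ ×ˢ I) (ξ, t) (1, 0) := by
  have h1 : HasFDerivWithinAt (fun p : ℝ × ℝ => φ p.1 p.2)
      (fderivWithin ℝ (fun p : ℝ × ℝ => φ p.1 p.2) (Set.univ ×ˢ I) (ξ, t))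
      (Set.univ ×ˢ I) (ξ, t) :=
    ((ContDiffOn.differentiableOn h (by simp)) (ξ, t) ⟨trivial, ht⟩).hasFDerivWithinAt
  have h2 : HasDerivAt (fun x : ℝ => ((x, t) : ℝ × ℝ)) (1, 0) ξ :=
    (hasDerivAt_id ξ).prodMk (hasDerivAt_const ξ t)
  have h3 := h1.comp_hasDerivAt
    (f := fun x : ℝ => ((x, t) : ℝ × ℝ)) ξ h2 (Eventually.of_forall fun x => ⟨trivial, ht⟩)
  exact h3.deriv

theorem Sm.pd1 {I : Set ℝ} (hI : UniqueDiffOn ℝ I) {φ : ℝ → ℝ → ℝ} (h : Sm I φ) :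
    Sm I (pd1 φ) := by
  have h1 : ContDiffOn ℝ (⊤ : ℕ∞) (fderivWithin ℝ (fun p : ℝ × ℝ => φ p.1 p.2) (Set.univ ×ˢ I))
      (Set.univ ×ˢ I) :=
    ContDiffOn.fderivWithin h (uniqueDiffOn_univ.prod hI) (by simp)
  exact (h1.clm_apply contDiffOn_const).congr (fun p hp => pd1_eq h hp.2 p.1)

theorem Sm.contDiffAt {I : Set ℝ} (hI : IsOpen I) {φ : ℝ → ℝ → ℝ} (h : Sm I φ) {t : ℝ}
    (ht : t ∈ I) (ξ : ℝ) : ContDiffAt ℝ (⊤ : ℕ∞) (fun p : ℝ × ℝ => φ p.1 p.2) (ξ, t) :=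
  ContDiffOn.contDiffAt h ((isOpen_univ.prod hI).mem_nhds ⟨trivial, ht⟩)

theorem pd1_eq' {I : Set ℝ} (hI : IsOpen I) {φ : ℝ → ℝ → ℝ} (h : Sm I φ) {t : ℝ} (ht : t ∈ I)
    (ξ : ℝ) : pd1 φ ξ t = fderiv ℝ (fun p : ℝ × ℝ => φ p.1 p.2) (ξ, t) (1, 0) := by
  rw [pd1_eq h ht, fderivWithin_of_isOpen (isOpen_univ.prod hI) ⟨trivial, ht⟩]

theorem pdt_has {I : Set ℝ} (hI : IsOpen I) {φ : ℝ → ℝ → ℝ} (h : Sm I φ) {t : ℝ} (ht : t ∈ I)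
    (ξ : ℝ) : HasDerivAt (fun τ => φ ξ τ)
      (fderiv ℝ (fun p : ℝ × ℝ => φ p.1 p.2) (ξ, t) (0, 1)) t := by
  have h1 := ((h.contDiffAt hI ht ξ).differentiableAt (by simp)).hasFDerivAt
  have h2 : HasDerivAt (fun x : ℝ => ((ξ, x) : ℝ × ℝ)) (0, 1) t :=
    (hasDerivAt_const t ξ).prodMk (hasDerivAt_id t)
  exact h1.comp_hasDerivAt (f := fun x : ℝ => ((ξ, x) : ℝ × ℝ)) t h2

theorem pdt_eq {I : Set ℝ} (hI : IsOpen I) {φ : ℝ → ℝ → ℝ} (h : Sm I φ) {t : ℝ} (ht : t ∈ I)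
    (ξ : ℝ) : pdt φ ξ t = fderiv ℝ (fun p : ℝ × ℝ => φ p.1 p.2) (ξ, t) (0, 1) :=
  (pdt_has hI h ht ξ).deriv

theorem Sm.hasDerivT {I : Set ℝ} (hI : IsOpen I) {φ : ℝ → ℝ → ℝ} (h : Sm I φ) {t : ℝ}
    (ht : t ∈ I) (ξ : ℝ) : HasDerivAt (fun τ => φ ξ τ) (pdt φ ξ t) t :=
  (pdt_has hI h ht ξ).differentiableAt.hasDerivAt

theorem Sm.pdt {I : Set ℝ} (hI : IsOpen I) {φ : ℝ → ℝ → ℝ} (h : Sm I φ) :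
    Sm I (pdt φ) := by
  have h1 : ContDiffOn ℝ (⊤ : ℕ∞) (fderiv ℝ (fun p : ℝ × ℝ => φ p.1 p.2)) (Set.univ ×ˢ I) :=
    ContDiffOn.fderiv_of_isOpen h (isOpen_univ.prod hI) (by simp)
  exact (h1.clm_apply contDiffOn_const).congr (fun p hp => pdt_eq hI h hp.2 p.1)

theorem pd_comm {I : Set ℝ} (hI : IsOpen I) {φ : ℝ → ℝ → ℝ} (h : Sm I φ) {t : ℝ} (ht : t ∈ I)
    (ξ : ℝ) : _root_.pdt (_root_.pd1 φ) ξ t = _root_.pd1 (_root_.pdt φ) ξ t := by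
  have hs : IsOpen ((Set.univ : Set ℝ) ×ˢ I) := isOpen_univ.prod hI
  have hmem : ((Set.univ : Set ℝ) ×ˢ I) ∈ 𝓝 ((ξ, t) : ℝ × ℝ) := hs.mem_nhds ⟨trivial, ht⟩
  have h1 : ContDiffOn ℝ (⊤ : ℕ∞) (fderiv ℝ (fun p : ℝ × ℝ => φ p.1 p.2)) (Set.univ ×ˢ I) :=
    ContDiffOn.fderiv_of_isOpen h hs (by simp)
  have hd := ((h1.contDiffAt hmem).differentiableAt (by simp))
  rw [pdt_eq hI (h.pd1 hI.uniqueDiffOn) ht, pd1_eq' hI (h.pdt hI) ht]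
  have e1 : (fun p : ℝ × ℝ => _root_.pd1 φ p.1 p.2) =ᶠ[𝓝 (ξ, t)]
      fun p => fderiv ℝ (fun p : ℝ × ℝ => φ p.1 p.2) p (1, 0) := by
    filter_upwards [hmem] with p hp
    exact pd1_eq' hI h hp.2 p.1
  have e2 : (fun p : ℝ × ℝ => _root_.pdt φ p.1 p.2) =ᶠ[𝓝 (ξ, t)]
      fun p => fderiv ℝ (fun p : ℝ × ℝ => φ p.1 p.2) p (0, 1) := by
    filter_upwards [hmem] with p hp
    exact pdt_eq hI h hp.2 p.1
  rw [e1.fderiv_eq, e2.fderiv_eq]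
  have f1 : ∀ v : ℝ × ℝ, fderiv ℝ (fun p => fderiv ℝ (fun p : ℝ × ℝ => φ p.1 p.2) p v) (ξ, t)
      = (fderiv ℝ (fderiv ℝ (fun p : ℝ × ℝ => φ p.1 p.2)) (ξ, t)).flip v := by
    intro v
    rw [fderiv_clm_apply hd (differentiableAt_const v)]
    simp
  rw [f1, f1]
  simp only [ContinuousLinearMap.flip_apply]
  exact ((h.contDiffAt hI ht ξ).isSymmSndFDerivAt (by simp only [minSmoothness_of_isRCLikeNormedField]; exact show ((2 : ℕ∞) : WithTop ℕ∞) ≤ _ from WithTop.coe_le_coe.2 le_top)) _ _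

theorem Sm.add {I : Set ℝ} {φ ψ : ℝ → ℝ → ℝ} (h : Sm I φ) (k : Sm I ψ) :
    Sm I (fun x t => φ x t + ψ x t) := ContDiffOn.add h k
theorem Sm.sub {I : Set ℝ} {φ ψ : ℝ → ℝ → ℝ} (h : Sm I φ) (k : Sm I ψ) :
    Sm I (fun x t => φ x t - ψ x t) := ContDiffOn.sub h k
theorem Sm.mul {I : Set ℝ} {φ ψ : ℝ → ℝ → ℝ} (h : Sm I φ) (k : Sm I ψ) :
    Sm I (fun x t => φ x t * ψ x t) := ContDiffOn.mul h k
theorem Sm.neg {I : Set ℝ} {φ : ℝ → ℝ → ℝ} (h : Sm I φ) :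
    Sm I (fun x t => - φ x t) := ContDiffOn.neg h
theorem Sm.const {I : Set ℝ} (c : ℝ) : Sm I (fun _ _ => c) := contDiffOn_const
theorem Sm.exp {I : Set ℝ} {φ : ℝ → ℝ → ℝ} (h : Sm I φ) :
    Sm I (fun x t => Real.exp (φ x t)) := ContDiffOn.exp h
theorem Sm.log {I : Set ℝ} {φ : ℝ → ℝ → ℝ} (h : Sm I φ) (hp : ∀ x, ∀ t ∈ I, 0 < φ x t) :
    Sm I (fun x t => Real.log (φ x t)) :=
  ContDiffOn.log h (fun p hq => (hp p.1 p.2 hq.2).ne')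
theorem Sm.div {I : Set ℝ} {φ ψ : ℝ → ℝ → ℝ} (h : Sm I φ) (k : Sm I ψ)
    (hp : ∀ x, ∀ t ∈ I, 0 < ψ x t) :
    Sm I (fun x t => φ x t / ψ x t) :=
  ContDiffOn.div h k (fun p hq => (hp p.1 p.2 hq.2).ne')

theorem Sm.Ds {I : Set ℝ} (hI : UniqueDiffOn ℝ I) {φ ρ : ℝ → ℝ → ℝ} (h : Sm I φ) (k : Sm I ρ)
    (hp : ∀ x, ∀ t ∈ I, 0 < ρ x t) : Sm I (Ds ρ φ) := (h.pd1 hI).div k hp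

/-- arclength derivative, `HasDerivAt` form -/
theorem Sm.hasDs {I : Set ℝ} {φ ρ : ℝ → ℝ → ℝ} (h : Sm I φ) 
    (hp : ∀ x, ∀ t ∈ I, 0 < ρ x t) {t : ℝ} (ht : t ∈ I) (ξ : ℝ) :
    HasDerivAt (fun x => φ x t) (_root_.Ds ρ φ ξ t * ρ ξ t) ξ := by
  have := h.hasDeriv ht ξ
  unfold _root_.Ds
  rwa [div_mul_cancel₀ _ (hp ξ t ht).ne']

theorem Ds_of_has {φ ρ : ℝ → ℝ → ℝ} {ξ t d : ℝ} (hp : 0 < ρ ξ t)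
    (h : HasDerivAt (fun x => φ x t) (d * ρ ξ t) ξ) : Ds ρ φ ξ t = d := by
  unfold Ds pd1
  rw [h.deriv, mul_div_cancel_right₀ _ hp.ne']

/-- commutator of time and arclength derivatives -/
theorem pdt_Ds {I : Set ℝ} (hI : IsOpen I) {φ ρ : ℝ → ℝ → ℝ} (h : Sm I φ) (k : Sm I ρ)
    (hp : ∀ x, ∀ t ∈ I, 0 < ρ x t) {t : ℝ} (ht : t ∈ I) (ξ : ℝ) :
    HasDerivAt (fun τ => Ds ρ φ ξ τ)
      (Ds ρ (pdt φ) ξ t - pdt (fun x τ => Real.log (ρ x τ)) ξ t * Ds ρ φ ξ t) t := by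
  have h1 := (h.pd1 hI.uniqueDiffOn).hasDerivT hI ht ξ
  have h2 := k.hasDerivT hI ht ξ
  have h3 : pdt (fun x τ => Real.log (ρ x τ)) ξ t = pdt ρ ξ t / ρ ξ t :=
    (h2.log (hp ξ t ht).ne').deriv
  have h4 := h1.div h2 (hp ξ t ht).ne'
  have hρ := (hp ξ t ht).ne'
  rw [pd_comm hI h ht] at h4
  refine h4.congr_deriv ?_
  rw [h3]
  unfold Ds
  field_simp

/-- second derivative test at a spatial maximum -/
theorem max_test {I : Set ℝ} (hI : UniqueDiffOn ℝ I) {φ ρ : ℝ → ℝ → ℝ} (h : Sm I φ) (k : Sm I ρ)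
    (hp : ∀ x, ∀ t ∈ I, 0 < ρ x t) {t : ℝ} (ht : t ∈ I) (ξ : ℝ) (hm : ∀ x, φ x t ≤ φ ξ t) :
    Ds ρ φ ξ t = 0 ∧ Ds ρ (Ds ρ φ) ξ t ≤ 0 := by
  have hmax : IsLocalMax (fun x => φ x t) ξ := Eventually.of_forall hm
  have h0 : pd1 φ ξ t = 0 := hmax.deriv_eq_zero
  have hD : Ds ρ φ ξ t = 0 := by unfold Ds; rw [h0, zero_div]
  refine ⟨hD, ?_⟩
  by_contra hc
  push Not at hc
  have hpos := hp ξ t ht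
  have e : HasDerivAt (fun x => pd1 φ x t) (Ds ρ (Ds ρ φ) ξ t * ρ ξ t * ρ ξ t) ξ := by
    have h1 := ((h.Ds hI k hp).hasDs hp ht ξ).mul (k.hasDeriv ht ξ)
    rw [hD, zero_mul, add_zero] at h1
    refine h1.congr_of_eventuallyEq (Eventually.of_forall fun x => ?_)
    have := (hp x t ht).ne'
    simp only [Pi.mul_apply]
    unfold Ds
    field_simp
  have hdd : 0 < deriv (deriv (fun x => φ x t)) ξ := by
    have : deriv (deriv (fun x => φ x t)) ξ = _ := e.deriv
    rw [this]; positivity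
  have hmin := isLocalMin_of_deriv_deriv_pos hdd h0 (h.slice ht).continuous.continuousAt
  have hconst : (fun x => φ x t) =ᶠ[𝓝 ξ] fun _ => φ ξ t := by
    filter_upwards [hmin, hmax] with x h1 h2
    exact le_antisymm h2 h1
  have hd1 : deriv (fun x => φ x t) =ᶠ[𝓝 ξ] fun _ => 0 := by
    have := hconst.deriv
    simpa using this
  have := hd1.deriv_eq
  rw [this] at hdd
  simp at hdd

theorem per_red {φ : ℝ → ℝ} (hper : ∀ x, φ (x + 2 * π) = φ x) (x : ℝ) :
    ∃ y ∈ Set.Icc 0 (2 * π), φ y = φ x := by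
  have hP : Function.Periodic φ (2 * π) := hper
  obtain ⟨y, hy, he⟩ := hP.exists_mem_Ico₀ (by positivity) x
  exact ⟨y, ⟨hy.1, hy.2.le⟩, he.symm⟩

/-- The maximum principle. -/
theorem max_principle (a b : ℝ) (u : ℝ → ℝ → ℝ) (m : ℝ)
    (hper : ∀ x t, u (x + 2 * π) t = u x t)
    (hcont : ContinuousOn (fun p : ℝ × ℝ => u p.1 p.2) (Set.univ ×ˢ Set.Icc a b))
    (h0 : ∀ x, u x a ≤ m)
    (hmax : ∀ ξ t, a < t → t ≤ b → (∀ x, u x t ≤ u ξ t) → m < u ξ t →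
      ∃ d ≤ 0, HasDerivAt (fun τ => u ξ τ) d t) :
    ∀ ξ t, a ≤ t → t ≤ b → u ξ t ≤ m := by
  intro ξ0 t0 hat htb
  by_contra hc
  push Not at hc
  have hat' : a < t0 := by
    rcases hat.eq_or_lt with h | h
    · subst h; exact absurd (h0 ξ0) (not_le.mpr hc)
    · exact h
  obtain ⟨ε, hε, hε2⟩ : ∃ ε > 0, m < u ξ0 t0 - ε * (t0 - a) := by
    refine ⟨(u ξ0 t0 - m) / (2 * (t0 - a)), by apply div_pos <;> linarith, ?_⟩
    have : t0 - a ≠ 0 := by linarith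
    have : (u ξ0 t0 - m) / (2 * (t0 - a)) * (t0 - a) = (u ξ0 t0 - m) / 2 := by field_simp
    rw [this]; linarith
  have hK : IsCompact ((Set.Icc 0 (2 * π)) ×ˢ Set.Icc a t0 : Set (ℝ × ℝ)) :=
    isCompact_Icc.prod isCompact_Icc
  have hw : ContinuousOn (fun p : ℝ × ℝ => u p.1 p.2 - ε * (p.2 - a))
      ((Set.Icc 0 (2 * π)) ×ˢ Set.Icc a t0 : Set (ℝ × ℝ)) := by
    apply ContinuousOn.sub
    · exact hcont.mono (Set.prod_mono (Set.subset_univ _) (Set.Icc_subset_Icc le_rfl htb))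
    · fun_prop
  obtain ⟨⟨ξ1, t1⟩, ⟨hξ1, ht1⟩, hM⟩ := hK.exists_isMaxOn
    ⟨(0, a), ⟨⟨le_rfl, by positivity⟩, ⟨le_rfl, hat⟩⟩⟩ hw
  have hM' : ∀ x t, a ≤ t → t ≤ t0 → u x t - ε * (t - a) ≤ u ξ1 t1 - ε * (t1 - a) := by
    intro x t h1 h2
    obtain ⟨y, hy, he⟩ := per_red (φ := fun x => u x t) (fun x => hper x t) x
    have h3 : u y t - ε * (t - a) ≤ u ξ1 t1 - ε * (t1 - a) :=
      hM (show (y, t) ∈ _ from ⟨hy, ⟨h1, h2⟩⟩)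
    have h4 : u y t = u x t := he
    rwa [h4] at h3
  simp only [Set.mem_Icc] at ht1 hξ1
  have hgt := hM' ξ0 t0 hat le_rfl
  have ht1a : a < t1 := by
    rcases ht1.1.eq_or_lt with h | h
    · subst h
      have := h0 ξ1
      simp at hgt
      linarith
    · exact h
  have hprod : 0 ≤ ε * (t1 - a) := by apply mul_nonneg <;> linarith
  obtain ⟨d, hd, hder⟩ := hmax ξ1 t1 ht1a (ht1.2.trans htb)
    (fun x => by have := hM' x t1 ht1.1 ht1.2; linarith) (by linarith)
  -- w' = d - ε < 0, but w has a left max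
  have hder2 : HasDerivAt (fun τ => u ξ1 τ - ε * (τ - a)) (d - ε) t1 := by
    have := hder.sub (((hasDerivAt_id t1).sub_const a).const_mul ε)
    exact this.congr_deriv (by simp)
  have hslope := (hasDerivAt_iff_tendsto_slope.mp hder2).mono_left
    (nhdsWithin_mono (s := Set.Iio t1) t1 (fun x hx => (ne_of_lt hx : x ≠ t1)))
  have hge : 0 ≤ d - ε := by
    refine ge_of_tendsto hslope ?_
    filter_upwards [Ioo_mem_nhdsLT ht1a] with τ hτ
    rw [slope_def_field]
    have := hM' ξ1 τ hτ.1.le (hτ.2.le.trans ht1.2)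
    apply div_nonneg_of_nonpos <;> linarith [hτ.2]
  linarith

/-- scalar curvature in logarithmic variables -/
def RL (ρ F G : ℝ → ℝ → ℝ) (x t : ℝ) : ℝ :=
  -(Ds ρ (Ds ρ F) x t + Ds ρ F x t ^ 2 + 2 * Ds ρ (Ds ρ G) x t + 2 * Ds ρ G x t ^ 2)
    - Real.exp (2 * F x t - 4 * G x t) + 4 * Real.exp (-2 * G x t)
    - 2 * (Ds ρ F x t * Ds ρ G x t) - Ds ρ G x t ^ 2

theorem Sm.RL {I : Set ℝ} (hI : UniqueDiffOn ℝ I) {F G ρ : ℝ → ℝ → ℝ} (hF : Sm I F) (hG : Sm I G)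
    (k : Sm I ρ) (hp : ∀ x, ∀ t ∈ I, 0 < ρ x t) : Sm I (RL ρ F G) := by
  have ha := hF.Ds hI k hp
  have hb := hG.Ds hI k hp
  have hDa := ha.Ds hI k hp
  have hDb := hb.Ds hI k hp
  have hE := (((Sm.const 2).mul hF).sub ((Sm.const 4).mul hG)).exp
  have hH := ((Sm.const (-2)).mul hG).exp
  have := ((((((((hDa.add (ha.mul ha)).add ((Sm.const 2).mul hDb)).add
    ((Sm.const 2).mul (hb.mul hb))).neg).sub hE).add ((Sm.const 4).mul hH)).sub
    ((Sm.const 2).mul (ha.mul hb))).sub (hb.mul hb))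
  refine this.congr (fun x t _ => ?_)
  unfold _root_.RL
  ring

theorem R_evol {I : Set ℝ} (hI : IsOpen I) {F G ρ : ℝ → ℝ → ℝ} (hF : Sm I F) (hG : Sm I G)
    (k : Sm I ρ) (hp : ∀ x, ∀ t ∈ I, 0 < ρ x t)
    (eA : ∀ x, ∀ t ∈ I, pdt F x t = Ds ρ (Ds ρ F) x t + Ds ρ F x t ^ 2
      + 2 * (Ds ρ F x t * Ds ρ G x t) - 2 * Real.exp (2 * F x t - 4 * G x t))
    (eB : ∀ x, ∀ t ∈ I, pdt G x t = Ds ρ (Ds ρ G) x t + 2 * Ds ρ G x t ^ 2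
      + Ds ρ F x t * Ds ρ G x t + 2 * Real.exp (2 * F x t - 4 * G x t)
      - 4 * Real.exp (-2 * G x t))
    (eQ : ∀ x, ∀ t ∈ I, pdt (fun x τ => Real.log (ρ x τ)) x t = Ds ρ (Ds ρ F) x t
      + Ds ρ F x t ^ 2 + 2 * Ds ρ (Ds ρ G) x t + 2 * Ds ρ G x t ^ 2)
    {t : ℝ} (ht : t ∈ I) (ξ : ℝ) :
    pdt (RL ρ F G) ξ t = Ds ρ (Ds ρ (RL ρ F G)) ξ t
        + (Ds ρ F ξ t + 2 * Ds ρ G ξ t) * Ds ρ (RL ρ F G) ξ t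
        + (pdt (fun x τ => Real.log (ρ x τ)) ξ t ^ 2 + pdt F ξ t ^ 2 + 2 * pdt G ξ t ^ 2) := by
  have uI := hI.uniqueDiffOn (𝕜 := ℝ)
  set Q := pdt (fun x τ => Real.log (ρ x τ)) with hQdef
  set A := pdt F with hAdef
  set B := pdt G with hBdef
  set a := Ds ρ F with hadef
  set b := Ds ρ G with hbdef
  set E : ℝ → ℝ → ℝ := fun x t => Real.exp (2 * F x t - 4 * G x t) with hEdef
  set H : ℝ → ℝ → ℝ := fun x t => Real.exp (-2 * G x t) with hHdef
  have sa : Sm I a := hF.Ds uI k hp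
  have sb : Sm I b := hG.Ds uI k hp
  have sDa := sa.Ds uI k hp
  have sDb := sb.Ds uI k hp
  have sE : Sm I E := (((Sm.const 2).mul hF).sub ((Sm.const 4).mul hG)).exp
  have sH : Sm I H := ((Sm.const (-2)).mul hG).exp
  have sA : Sm I A := hF.pdt hI
  have sB : Sm I B := hG.pdt hI
  have sQ : Sm I Q := (k.log hp).pdt hI
  have sDA := sA.Ds uI k hp
  have sDB := sB.Ds uI k hp
  have sDQ := sQ.Ds uI k hp
  have eA' : ∀ x, ∀ t ∈ I, A x t = Ds ρ a x t + a x t ^ 2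
      + 2 * (a x t * b x t) - 2 * E x t := eA
  have eB' : ∀ x, ∀ t ∈ I, B x t = Ds ρ b x t + 2 * b x t ^ 2
      + a x t * b x t + 2 * E x t - 4 * H x t := eB
  have eQ' : ∀ x, ∀ t ∈ I, Q x t = Ds ρ a x t
      + a x t ^ 2 + 2 * Ds ρ b x t + 2 * b x t ^ 2 := eQ
  have eR : ∀ x, ∀ t ∈ I, RL ρ F G x t = -(A x t + 2 * B x t + Q x t) / 2 := by
    intro x t ht
    rw [eA' x t ht, eB' x t ht, eQ' x t ht]
    simp only [RL, hEdef, hHdef, hadef, hbdef]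
    ring
  have eQ2 : ∀ x, ∀ t ∈ I, Q x t = A x t + 2 * B x t
      - (2 * b x t ^ 2 + 4 * (a x t * b x t) + 2 * E x t - 8 * H x t) := by
    intro x t ht
    rw [eA' x t ht, eB' x t ht, eQ' x t ht]
    ring
  have cg : ∀ {φ : ℝ → ℝ → ℝ} {ψ : ℝ → ℝ} {d : ℝ} (x : ℝ), (∀ x, φ x t = ψ x) →
      HasDerivAt ψ (d * ρ x t) x → Ds ρ φ x t = d := by
    intro φ ψ d x he h
    apply Ds_of_has (hp x t ht)
    exact h.congr_of_eventuallyEq (Eventually.of_forall fun y => he y)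
  have dF := fun x => hF.hasDs hp ht x
  have dG := fun x => hG.hasDs hp ht x
  have da := fun x => sa.hasDs hp ht x
  have db := fun x => sb.hasDs hp ht x
  have dDa := fun x => sDa.hasDs hp ht x
  have dDb := fun x => sDb.hasDs hp ht x
  have dA := fun x => sA.hasDs hp ht x
  have dB := fun x => sB.hasDs hp ht x
  have dQ := fun x => sQ.hasDs hp ht x
  have dDA := fun x => sDA.hasDs hp ht x
  have dDB := fun x => sDB.hasDs hp ht x
  have dDQ := fun x => sDQ.hasDs hp ht x
  have dE : ∀ x, HasDerivAt (fun x => E x t) (E x t * (2 * a x t - 4 * b x t) * ρ x t) x := by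
    intro x
    exact (((dF x).const_mul 2).sub ((dG x).const_mul 4)).exp.congr_deriv
      (by simp only [hEdef, Pi.sub_apply]; ring)
  have dH : ∀ x, HasDerivAt (fun x => H x t) (-2 * H x t * b x t * ρ x t) x := by
    intro x
    exact ((dG x).const_mul (-2)).exp.congr_deriv (by simp only [hHdef]; ring)
  have xA : Ds ρ A ξ t = Ds ρ (Ds ρ a) ξ t + 2 * a ξ t * Ds ρ a ξ t
      + 2 * (a ξ t * Ds ρ b ξ t + b ξ t * Ds ρ a ξ t) - 2 * (E ξ t * (2 * a ξ t - 4 * b ξ t)) := by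
    refine cg ξ (fun x => eA' x t ht) ?_
    exact ((((dDa ξ).add ((da ξ).pow 2)).add (((da ξ).mul (db ξ)).const_mul 2)).sub
      ((dE ξ).const_mul 2)).congr_deriv (by push_cast; ring)
  have xB : Ds ρ B ξ t = Ds ρ (Ds ρ b) ξ t + 4 * b ξ t * Ds ρ b ξ t
      + (a ξ t * Ds ρ b ξ t + b ξ t * Ds ρ a ξ t) + 2 * (E ξ t * (2 * a ξ t - 4 * b ξ t))
      + 8 * H ξ t * b ξ t := by
    refine cg ξ (fun x => eB' x t ht) ?_
    exact (((((dDb ξ).add (((db ξ).pow 2).const_mul 2)).add ((da ξ).mul (db ξ))).add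
      ((dE ξ).const_mul 2)).sub ((dH ξ).const_mul 4)).congr_deriv (by push_cast; ring)
  have xQ : ∀ x, Ds ρ Q x t = Ds ρ A x t + 2 * Ds ρ B x t
      - (4 * (b x t * Ds ρ b x t) + 4 * (a x t * Ds ρ b x t + b x t * Ds ρ a x t)
        + 2 * (E x t * (2 * a x t - 4 * b x t)) + 16 * (H x t * b x t)) := by
    intro x
    refine cg x (fun x => eQ2 x t ht) ?_
    exact (((dA x).add ((dB x).const_mul 2)).sub
      ((((((db x).pow 2).const_mul 2).add (((da x).mul (db x)).const_mul 4)).add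
        ((dE x).const_mul 2)).sub ((dH x).const_mul 8))).congr_deriv (by push_cast; ring)
  have xQQ : Ds ρ (Ds ρ Q) ξ t = Ds ρ (Ds ρ A) ξ t + 2 * Ds ρ (Ds ρ B) ξ t
      - (4 * (b ξ t * Ds ρ (Ds ρ b) ξ t + Ds ρ b ξ t ^ 2)
        + 4 * (a ξ t * Ds ρ (Ds ρ b) ξ t + 2 * (Ds ρ a ξ t * Ds ρ b ξ t)
          + b ξ t * Ds ρ (Ds ρ a) ξ t)
        + 2 * (E ξ t * (2 * a ξ t - 4 * b ξ t) ^ 2 + E ξ t * (2 * Ds ρ a ξ t - 4 * Ds ρ b ξ t))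
        + 16 * (H ξ t * Ds ρ b ξ t - 2 * H ξ t * b ξ t ^ 2)) := by
    refine cg ξ xQ ?_
    exact (((dDA ξ).add ((dDB ξ).const_mul 2)).sub
      ((((((db ξ).mul (dDb ξ)).const_mul 4).add
        ((((da ξ).mul (dDb ξ)).add ((db ξ).mul (dDa ξ))).const_mul 4)).add
        (((dE ξ).mul (((da ξ).const_mul 2).sub ((db ξ).const_mul 4))).const_mul 2)).add
        (((dH ξ).mul (db ξ)).const_mul 16))).congr_deriv
      (by simp only [Pi.sub_apply]; ring)
  have xR : ∀ x, Ds ρ (RL ρ F G) x t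
      = -(Ds ρ A x t + 2 * Ds ρ B x t + Ds ρ Q x t) / 2 := by
    intro x
    refine cg x (fun x => eR x t ht) ?_
    exact ((((dA x).add ((dB x).const_mul 2)).add (dQ x)).neg.div_const 2).congr_deriv (by ring)
  have xRR : Ds ρ (Ds ρ (RL ρ F G)) ξ t
      = -(Ds ρ (Ds ρ A) ξ t + 2 * Ds ρ (Ds ρ B) ξ t + Ds ρ (Ds ρ Q) ξ t) / 2 := by
    refine cg ξ xR ?_
    exact ((((dDA ξ).add ((dDB ξ).const_mul 2)).add (dDQ ξ)).neg.div_const 2).congr_deriv (by ring)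
  -- time derivatives
  have ta : ∀ x, ∀ t ∈ I, HasDerivAt (fun τ => a x τ) (Ds ρ A x t - Q x t * a x t) t :=
    fun x t ht => pdt_Ds hI hF k hp ht x
  have tb : ∀ x, ∀ t ∈ I, HasDerivAt (fun τ => b x τ) (Ds ρ B x t - Q x t * b x t) t :=
    fun x t ht => pdt_Ds hI hG k hp ht x
  have xat : Ds ρ (pdt a) ξ t = Ds ρ (Ds ρ A) ξ t - (Ds ρ Q ξ t * a ξ t + Q ξ t * Ds ρ a ξ t) := by
    refine cg (ψ := fun x => Ds ρ A x t - Q x t * a x t) ξ (fun x => (ta x t ht).deriv) ?_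
    exact ((dDA ξ).sub ((dQ ξ).mul (da ξ))).congr_deriv (by ring)
  have xbt : Ds ρ (pdt b) ξ t = Ds ρ (Ds ρ B) ξ t - (Ds ρ Q ξ t * b ξ t + Q ξ t * Ds ρ b ξ t) := by
    refine cg (ψ := fun x => Ds ρ B x t - Q x t * b x t) ξ (fun x => (tb x t ht).deriv) ?_
    exact ((dDB ξ).sub ((dQ ξ).mul (db ξ))).congr_deriv (by ring)
  have tDa := pdt_Ds hI sa k hp ht ξ
  have tDb := pdt_Ds hI sb k hp ht ξ
  rw [xat] at tDa
  rw [xbt] at tDb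
  have tF := hF.hasDerivT hI ht ξ
  have tG := hG.hasDerivT hI ht ξ
  have tE : HasDerivAt (fun τ => E ξ τ) (E ξ t * (2 * A ξ t - 4 * B ξ t)) t :=
    ((tF.const_mul 2).sub (tG.const_mul 4)).exp.congr_deriv
      (by simp only [hEdef, Pi.sub_apply, hAdef, hBdef])
  have tH : HasDerivAt (fun τ => H ξ τ) (-2 * H ξ t * B ξ t) t :=
    (tG.const_mul (-2)).exp.congr_deriv (by simp only [hHdef, hBdef]; ring)
  have ta' := ta ξ t ht
  have tb' := tb ξ t ht
  have tR : pdt (RL ρ F G) ξ t = _ := 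
    (((((((tDa.add (ta'.pow 2)).add (tDb.const_mul 2)).add ((tb'.pow 2).const_mul 2)).neg.sub
      tE).add (tH.const_mul 4)).sub ((ta'.mul tb').const_mul 2)).sub (tb'.pow 2)).deriv
  rw [tR, xRR, xR ξ, xQQ, xQ ξ]
  have hA0 := eA' ξ t ht
  have hB0 := eB' ξ t ht
  have hQ0 := eQ' ξ t ht
  have q : pdt (fun x τ => Real.log (ρ x τ)) ξ t = Q ξ t := rfl
  rw [q]
  push_cast
  have hDDa : Ds ρ (Ds ρ a) ξ t = Ds ρ A ξ t - (2 * a ξ t * Ds ρ a ξ t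
      + 2 * (a ξ t * Ds ρ b ξ t + b ξ t * Ds ρ a ξ t) - 2 * (E ξ t * (2 * a ξ t - 4 * b ξ t))) := by
    linarith
  have hDDb : Ds ρ (Ds ρ b) ξ t = Ds ρ B ξ t - (4 * b ξ t * Ds ρ b ξ t
      + (a ξ t * Ds ρ b ξ t + b ξ t * Ds ρ a ξ t) + 2 * (E ξ t * (2 * a ξ t - 4 * b ξ t))
      + 8 * H ξ t * b ξ t) := by linarith
  rw [hDDa, hDDb, hQ0]
  generalize Ds ρ (Ds ρ A) ξ t = DDA
  generalize Ds ρ (Ds ρ B) ξ t = DDB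
  generalize Ds ρ A ξ t = DA
  generalize Ds ρ B ξ t = DB
  rw [hA0, hB0]
  generalize Ds ρ a ξ t = Da
  generalize Ds ρ b ξ t = Db
  generalize a ξ t = a0
  generalize b ξ t = b0
  generalize E ξ t = E0
  generalize H ξ t = H0
  ring

theorem Ds_per {φ ρ : ℝ → ℝ → ℝ} (hφ : ∀ x t, φ (x + 2 * π) t = φ x t)
    (hρ : ∀ x t, ρ (x + 2 * π) t = ρ x t) (x t : ℝ) : Ds ρ φ (x + 2 * π) t = Ds ρ φ x t := by
  unfold Ds pd1
  rw [hρ, ← deriv_comp_add_const]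
  simp only [hφ]

theorem RL_per {F G ρ : ℝ → ℝ → ℝ} (hF : ∀ x t, F (x + 2 * π) t = F x t)
    (hG : ∀ x t, G (x + 2 * π) t = G x t)
    (hρ : ∀ x t, ρ (x + 2 * π) t = ρ x t) (x t : ℝ) : RL ρ F G (x + 2 * π) t = RL ρ F G x t := by
  unfold RL
  rw [Ds_per (Ds_per hF hρ) hρ, Ds_per (Ds_per hG hρ) hρ, Ds_per hF hρ, Ds_per hG hρ, hF, hG]

theorem per_bdd {φ : ℝ → ℝ} (hper : ∀ x, φ (x + 2 * π) = φ x) (hc : Continuous φ) :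
    ∃ C, ∀ x, |φ x| ≤ C := by
  obtain ⟨C, hC⟩ := (isCompact_Icc (a := (0:ℝ)) (b := 2 * π)).exists_bound_of_continuousOn
    hc.continuousOn
  refine ⟨C, fun x => ?_⟩
  obtain ⟨y, hy, he⟩ := per_red hper x
  rw [← he]
  exact hC y hy

theorem Ds_sub {I : Set ℝ} {φ ψ ρ : ℝ → ℝ → ℝ} (h : Sm I φ) (k : Sm I ψ)
    (hp : ∀ x, ∀ t ∈ I, 0 < ρ x t) {t : ℝ} (ht : t ∈ I) (ξ : ℝ) :
    Ds ρ (fun x t => φ x t - ψ x t) ξ t = Ds ρ φ ξ t - Ds ρ ψ ξ t := by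
  apply Ds_of_has (hp ξ t ht)
  exact ((h.hasDs hp ht ξ).sub (k.hasDs hp ht ξ)).congr_deriv (by ring)

theorem DDs_sub {I : Set ℝ} (hI : UniqueDiffOn ℝ I) {φ ψ ρ : ℝ → ℝ → ℝ} (h : Sm I φ) (k : Sm I ψ)
    (hr : Sm I ρ) (hp : ∀ x, ∀ t ∈ I, 0 < ρ x t) {t : ℝ} (ht : t ∈ I) (ξ : ℝ) :
    Ds ρ (Ds ρ (fun x t => φ x t - ψ x t)) ξ t = Ds ρ (Ds ρ φ) ξ t - Ds ρ (Ds ρ ψ) ξ t := by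
  apply Ds_of_has (hp ξ t ht)
  refine ((((h.Ds hI hr hp).hasDs hp ht ξ).sub
    ((k.Ds hI hr hp).hasDs hp ht ξ)).congr_deriv (by ring)).congr_of_eventuallyEq ?_
  exact Eventually.of_forall fun x => Ds_sub h k hp ht x

theorem core (T : ℝ) (hT : 0 < T) (F G ρ : ℝ → ℝ → ℝ) (hF : Sm (Set.Ico 0 T) F)
    (hG : Sm (Set.Ico 0 T) G) (k : Sm (Set.Ico 0 T) ρ)
    (hp : ∀ x, ∀ t ∈ Set.Ico 0 T, 0 < ρ x t)
    (pF : ∀ x t, F (x + 2 * π) t = F x t) (pG : ∀ x t, G (x + 2 * π) t = G x t)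
    (pρ : ∀ x t, ρ (x + 2 * π) t = ρ x t)
    (eA : ∀ x, ∀ t ∈ Set.Ioo 0 T, pdt F x t = Ds ρ (Ds ρ F) x t + Ds ρ F x t ^ 2
      + 2 * (Ds ρ F x t * Ds ρ G x t) - 2 * Real.exp (2 * F x t - 4 * G x t))
    (eB : ∀ x, ∀ t ∈ Set.Ioo 0 T, pdt G x t = Ds ρ (Ds ρ G) x t + 2 * Ds ρ G x t ^ 2
      + Ds ρ F x t * Ds ρ G x t + 2 * Real.exp (2 * F x t - 4 * G x t)
      - 4 * Real.exp (-2 * G x t))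
    (eQ : ∀ x, ∀ t ∈ Set.Ioo 0 T, pdt (fun x τ => Real.log (ρ x τ)) x t = Ds ρ (Ds ρ F) x t
      + Ds ρ F x t ^ 2 + 2 * Ds ρ (Ds ρ G) x t + 2 * Ds ρ G x t ^ 2)
    (h_order : ∀ x, F x 0 ≤ G x 0) (r s : ℝ) (hr : r ≤ 0) (hs : ∀ x, Real.exp (2 * G x 0) ≤ s)
    (hR : ∀ x, r ≤ RL ρ F G x 0) (hrs : -3 < r * s) :
    ∃ c : ℝ, 0 < c ∧ ∀ x t, 0 ≤ t → t < T →
      c * (T - t) ≤ Real.exp (2 * F x t) ∧ F x t ≤ G x t := by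
  have uI : UniqueDiffOn ℝ (Set.Ico 0 T) := uniqueDiffOn_Ico 0 T
  have oI : IsOpen (Set.Ioo 0 T) := isOpen_Ioo
  have sub : Set.Ioo 0 T ⊆ Set.Ico 0 T := Set.Ioo_subset_Ico_self
  have h0 : (0:ℝ) ∈ Set.Ico 0 T := ⟨le_rfl, hT⟩
  have tF := fun {t} (ht : t ∈ Set.Ioo 0 T) x => (hF.mono sub).hasDerivT oI ht x
  have tG := fun {t} (ht : t ∈ Set.Ioo 0 T) x => (hG.mono sub).hasDerivT oI ht x
  -- general max principle on `[0,T)`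
  have MP : ∀ (u : ℝ → ℝ → ℝ) (m : ℝ), Sm (Set.Ico 0 T) u →
      (∀ x t, u (x + 2 * π) t = u x t) → (∀ x, u x 0 ≤ m) →
      (∀ ξ, ∀ t ∈ Set.Ioo 0 T, Ds ρ u ξ t = 0 → Ds ρ (Ds ρ u) ξ t ≤ 0 → m < u ξ t →
        pdt u ξ t ≤ 0) → ∀ ξ t, 0 ≤ t → t < T → u ξ t ≤ m := by
    intro u m hu pu u0 hd ξ t ht0 htT
    refine max_principle 0 t u m pu ?_ u0 ?_ ξ t ht0 le_rfl
    · exact (ContDiffOn.continuousOn hu).mono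
        (Set.prod_mono le_rfl (fun τ hτ => ⟨hτ.1, hτ.2.trans_lt htT⟩))
    · intro y τ h1 h2 h3 h4
      have hτ : τ ∈ Set.Ioo 0 T := ⟨h1, h2.trans_lt htT⟩
      obtain ⟨e1, e2⟩ := max_test uI hu k hp (sub hτ) y h3
      exact ⟨_, hd y τ hτ e1 e2 h4, (hu.mono sub).hasDerivT oI hτ y⟩
  have hEH : ∀ x t, F x t ≤ G x t → Real.exp (2 * F x t - 4 * G x t) ≤ Real.exp (-2 * G x t) := by
    intro x t h
    apply Real.exp_le_exp.mpr; linarith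
  have hHE : ∀ x t, G x t ≤ F x t → Real.exp (-2 * G x t) ≤ Real.exp (2 * F x t - 4 * G x t) := by
    intro x t h
    apply Real.exp_le_exp.mpr; linarith
  -- (i) order preserved
  have ord : ∀ x t, 0 ≤ t → t < T → F x t ≤ G x t := by
    intro x t h1 h2
    have := MP (fun x t => F x t - G x t) 0 (hF.sub hG) (fun x t => by simp only [pF, pG])
      (fun x => by linarith [h_order x]) ?_ x t h1 h2
    · linarith
    · intro ξ t ht d1 d2 hpos
      rw [Ds_sub hF hG hp (sub ht)] at d1
      rw [DDs_sub uI hF hG k hp (sub ht)] at d2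
      have e : pdt (fun x t => F x t - G x t) ξ t = pdt F ξ t - pdt G ξ t :=
        ((tF ht ξ).sub (tG ht ξ)).deriv
      rw [e, eA ξ t ht, eB ξ t ht]
      have hab : Ds ρ F ξ t = Ds ρ G ξ t := by linarith
      rw [hab]
      have := hHE ξ t (by linarith)
      nlinarith
  -- (ii) ratio bounded
  obtain ⟨m, hm⟩ := per_bdd (φ := fun x => G x 0 - F x 0) (fun x => by simp only [pF, pG])
    ((hG.slice h0).continuous.sub (hF.slice h0).continuous)
  have rat : ∀ x t, 0 ≤ t → t < T → G x t - F x t ≤ m := by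
    refine MP (fun x t => G x t - F x t) m (hG.sub hF) (fun x t => by simp only [pF, pG])
      (fun x => (le_abs_self _).trans (hm x)) ?_
    intro ξ t ht d1 d2 hpos
    rw [Ds_sub hG hF hp (sub ht)] at d1
    rw [DDs_sub uI hG hF k hp (sub ht)] at d2
    have e : pdt (fun x t => G x t - F x t) ξ t = pdt G ξ t - pdt F ξ t :=
      ((tG ht ξ).sub (tF ht ξ)).deriv
    rw [e, eA ξ t ht, eB ξ t ht]
    have hab : Ds ρ F ξ t = Ds ρ G ξ t := by linarith
    rw [hab]
    have := hEH ξ t (ord ξ t ht.1.le ht.2)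
    nlinarith
  -- (iii) g bounded
  have spos : 0 < s := (Real.exp_pos _).trans_le (hs 0)
  have gb : ∀ x t, 0 ≤ t → t < T → Real.exp (2 * G x t) ≤ s := by
    intro x t h1 h2
    have := MP G (Real.log s / 2) hG pG (fun x => by
      have := (Real.le_log_iff_exp_le spos).mpr (hs x)
      linarith) ?_ x t h1 h2
    · rw [← Real.le_log_iff_exp_le spos]; linarith
    · intro ξ t ht d1 d2 hpos
      rw [eB ξ t ht, d1]
      have := hEH ξ t (ord ξ t ht.1.le ht.2)
      have := Real.exp_pos (-2 * G ξ t)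
      linarith
  -- (iv) scalar curvature
  have sR : Sm (Set.Ico 0 T) (RL ρ F G) := Sm.RL uI hF hG k hp
  have Rb : ∀ x t, 0 ≤ t → t < T → r ≤ RL ρ F G x t := by
    intro x t h1 h2
    have s0 : Sm (Set.Ico 0 T) (fun _ _ => (0:ℝ)) := Sm.const 0
    have D0 : ∀ x t, Ds ρ (fun _ _ => (0:ℝ)) x t = 0 := by
      intro x t; simp [Ds, pd1]
    have D0' : Ds ρ (fun _ _ => (0:ℝ)) = fun _ _ => 0 := by
      funext x t; exact D0 x t
    have := MP (fun x t => 0 - RL ρ F G x t) (-r) (s0.sub sR)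
      (fun x t => by rw [RL_per pF pG pρ]) (fun x => by linarith [hR x]) ?_ x t h1 h2
    · linarith
    · intro ξ t ht d1 d2 _
      rw [Ds_sub s0 sR hp (sub ht), D0] at d1
      rw [DDs_sub uI s0 sR k hp (sub ht), D0', D0] at d2
      have e : pdt (fun x t => 0 - RL ρ F G x t) ξ t = 0 - pdt (RL ρ F G) ξ t :=
        ((hasDerivAt_const t (0:ℝ)).sub ((sR.mono sub).hasDerivT oI ht ξ)).deriv
      rw [e, R_evol oI (hF.mono sub) (hG.mono sub) (k.mono sub) (fun x t ht => hp x t (sub ht))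
        eA eB eQ ht ξ]
      have hz : Ds ρ (RL ρ F G) ξ t = 0 := by linarith
      rw [hz]
      have q1 := sq_nonneg (pdt (fun x τ => Real.log (ρ x τ)) ξ t)
      have q2 := sq_nonneg (pdt F ξ t)
      have q3 := sq_nonneg (pdt G ξ t)
      linarith
  -- (v) volume of the fibers
  obtain ⟨δ, hδ, hδ3⟩ : ∃ δ > 0, r * s = -3 + δ := ⟨r * s + 3, by linarith, by ring⟩
  have Vt : ∀ ξ, ∀ t ∈ Set.Ioo 0 T, Ds ρ F ξ t + 2 * Ds ρ G ξ t = 0 →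
      pdt F ξ t + 2 * pdt G ξ t ≤ -δ * Real.exp (-2 * G ξ t) := by
    intro ξ t ht hc
    have hR' := Rb ξ t ht.1.le ht.2
    have hid : pdt F ξ t + 2 * pdt G ξ t = - RL ρ F G ξ t + Ds ρ G ξ t ^ 2
        + 2 * (Ds ρ F ξ t * Ds ρ G ξ t) + Real.exp (2 * F ξ t - 4 * G ξ t)
        - 4 * Real.exp (-2 * G ξ t) := by
      rw [eA ξ t ht, eB ξ t ht, RL]; ring
    have ha : Ds ρ F ξ t = -2 * Ds ρ G ξ t := by linarith
    rw [hid, ha]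
    have hE := hEH ξ t (ord ξ t ht.1.le ht.2)
    have hg := gb ξ t ht.1.le ht.2
    have hH := Real.exp_pos (-2 * G ξ t)
    have hHg : Real.exp (-2 * G ξ t) * Real.exp (2 * G ξ t) = 1 := by
      rw [← Real.exp_add]; simp
    have key : -r ≤ (3 - δ) * Real.exp (-2 * G ξ t) := by
      have h1 : 1 ≤ Real.exp (-2 * G ξ t) * s := by
        rw [← hHg]; exact mul_le_mul_of_nonneg_left hg hH.le
      have h2 : (-r) * 1 ≤ (-r) * (Real.exp (-2 * G ξ t) * s) :=
        mul_le_mul_of_nonneg_left h1 (by linarith)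
      have h3 : (-r) * (Real.exp (-2 * G ξ t) * s) = (-(r * s)) * Real.exp (-2 * G ξ t) := by ring
      rw [h3, hδ3] at h2
      linarith
    nlinarith [sq_nonneg (Ds ρ G ξ t)]
  set c := 2 / 3 * δ * Real.exp (-(2 / 3) * m) with hcdef
  have hcpos : 0 < c := by positivity
  set u : ℝ → ℝ → ℝ := fun x t => Real.exp (2 / 3 * (F x t + 2 * G x t)) with hudef
  have su : Sm (Set.Ico 0 T) u := ((Sm.const (2 / 3)).mul (hF.add ((Sm.const 2).mul hG))).exp
  have ut : ∀ ξ, ∀ t ∈ Set.Ioo 0 T, (∀ x, u ξ t ≤ u x t) → 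
      ∃ d, d ≤ -c ∧ HasDerivAt (fun τ => u ξ τ) d t := by
    intro ξ t ht hmin
    have hx : HasDerivAt (fun x => u x t)
        (u ξ t * (2 / 3 * (Ds ρ F ξ t + 2 * Ds ρ G ξ t) * ρ ξ t)) ξ :=
      (((hF.hasDs hp (sub ht) ξ).add ((hG.hasDs hp (sub ht) ξ).const_mul 2)).const_mul
        (2 / 3)).exp.congr_deriv (by simp only [hudef, Pi.add_apply]; ring)
    have hz := IsLocalMin.hasDerivAt_eq_zero
      (show IsLocalMin (fun x => u x t) ξ from Eventually.of_forall hmin) hx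
    have upos : 0 < u ξ t := Real.exp_pos _
    have hcr : Ds ρ F ξ t + 2 * Ds ρ G ξ t = 0 := by
      have := hp ξ t (sub ht)
      rcases mul_eq_zero.mp hz with h | h
      · exact absurd h upos.ne'
      · rcases mul_eq_zero.mp h with h | h
        · linarith
        · exact absurd h this.ne'
    refine ⟨u ξ t * (2 / 3 * (pdt F ξ t + 2 * pdt G ξ t)), ?_, ?_⟩
    · have h1 := Vt ξ t ht hcr
      have h2 : u ξ t * (2 / 3 * (pdt F ξ t + 2 * pdt G ξ t)) ≤
          u ξ t * (2 / 3 * (-δ * Real.exp (-2 * G ξ t))) := by gcongr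
      refine h2.trans ?_
      have h3 : u ξ t * Real.exp (-2 * G ξ t) = Real.exp (-(2 / 3) * (G ξ t - F ξ t)) := by
        simp only [hudef]
        rw [← Real.exp_add]; congr 1; ring
      have h4 : Real.exp (-(2 / 3) * m) ≤ Real.exp (-(2 / 3) * (G ξ t - F ξ t)) := by
        apply Real.exp_le_exp.mpr
        linarith [rat ξ t ht.1.le ht.2]
      have h5 : u ξ t * (2 / 3 * (-δ * Real.exp (-2 * G ξ t)))
          = -(2 / 3 * δ * (u ξ t * Real.exp (-2 * G ξ t))) := by ring
      rw [h5, h3, hcdef]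
      have : 2 / 3 * δ * Real.exp (-(2 / 3) * m) ≤
        2 / 3 * δ * Real.exp (-(2 / 3) * (G ξ t - F ξ t)) := by gcongr
      linarith
    · exact (((tF ht ξ).add ((tG ht ξ).const_mul 2)).const_mul
        (2 / 3)).exp.congr_deriv (by simp only [hudef, Pi.add_apply])
  -- time-reversed maximum principle
  have ub : ∀ x t b, 0 < t → t < b → b < T → c * (b - t) ≤ u x t := by
    intro x t b h1 h2 h3
    have := max_principle 0 (b - t) (fun x τ => -(u x (b - τ) + c * (b - τ))) (-(c * b))
      (fun x τ => by simp only [hudef, pF, pG]) ?_ ?_ ?_ x (b - t) (by linarith) le_rfl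
    · simp only [sub_sub_cancel] at this
      linarith
    · have hc2 : ContinuousOn (fun p : ℝ × ℝ => u p.1 (b - p.2))
          (Set.univ ×ˢ Set.Icc 0 (b - t)) := by
        have h4 : ContinuousOn (fun p : ℝ × ℝ => ((p.1, b - p.2) : ℝ × ℝ))
          (Set.univ ×ˢ Set.Icc 0 (b - t)) := by fun_prop
        exact ContinuousOn.comp (g := fun p : ℝ × ℝ => u p.1 p.2)
          (f := fun p : ℝ × ℝ => (p.1, b - p.2)) (ContDiffOn.continuousOn su) h4
          (fun p hq => ⟨trivial, ⟨by linarith [hq.2.2], by linarith [hq.2.1]⟩⟩)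
      exact (hc2.add (by fun_prop)).neg
    · intro y
      have : 0 < u y (b - 0) := Real.exp_pos _
      simp only [sub_zero] at this ⊢
      linarith
    · intro ξ τ g1 g2 g3 g4
      have ht : b - τ ∈ Set.Ioo 0 T := ⟨by linarith, by linarith⟩
      obtain ⟨d, hd, hder⟩ := ut ξ (b - τ) ht (fun x => by have := g3 x; linarith)
      refine ⟨d + c, by linarith, ?_⟩
      have e1 := HasDerivAt.comp_const_sub b τ hder
      have e2 := ((hasDerivAt_id τ).const_sub b).const_mul c
      exact (e1.add e2).neg.congr_deriv (by ring)
  have ub2 : ∀ x t, 0 < t → t < T → c * (T - t) ≤ u x t := by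
    intro x t h1 h2
    have hten : Tendsto (fun b => c * (b - t)) (𝓝[<] T) (𝓝 (c * (T - t))) :=
      (Continuous.tendsto (by fun_prop) T).mono_left nhdsWithin_le_nhds
    refine le_of_tendsto hten ?_
    filter_upwards [Ioo_mem_nhdsLT h2] with b hb
    exact ub x t b h1 hb.1 hb.2
  have ub3 : ∀ x t, 0 ≤ t → t < T → c * (T - t) ≤ u x t := by
    intro x t h1 h2
    rcases h1.eq_or_lt with h | h
    · subst h
      have hten : Tendsto (fun t => c * (T - t)) (𝓝[>] 0) (𝓝 (c * (T - 0))) :=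
        (Continuous.tendsto (by fun_prop) 0).mono_left nhdsWithin_le_nhds
      have hcu : ContinuousOn (fun t => u x t) (Set.Ico 0 T) :=
        ContinuousOn.comp (g := fun p : ℝ × ℝ => u p.1 p.2) (f := fun t => (x, t))
          (ContDiffOn.continuousOn su)
          (by fun_prop) (fun t ht => ⟨trivial, ht⟩)
      have hten2 : Tendsto (fun t => u x t) (𝓝[>] 0) (𝓝 (u x 0)) := by
        have h5 : Tendsto (fun t => u x t) (𝓝[Set.Ico 0 T] 0) (𝓝 (u x 0)) := hcu 0 h0
        refine h5.mono_left ?_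
        rw [← nhdsWithin_Ioo_eq_nhdsGT hT]
        exact nhdsWithin_mono _ sub
      refine le_of_tendsto_of_tendsto hten hten2 ?_
      filter_upwards [Ioo_mem_nhdsGT hT] with t ht
      exact ub2 x t ht.1 ht.2
    · exact ub2 x t h h2
  refine ⟨c * Real.exp (-(4 / 3) * m), by positivity, fun x t h1 h2 => ⟨?_, ord x t h1 h2⟩⟩
  have h3 := ub3 x t h1 h2
  have h4 := rat x t h1 h2
  have h5 : u x t * Real.exp (-(4 / 3) * m) ≤ Real.exp (2 * F x t) := by
    simp only [hudef]
    rw [← Real.exp_add]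
    apply Real.exp_le_exp.mpr
    linarith
  calc c * Real.exp (-(4 / 3) * m) * (T - t) = c * (T - t) * Real.exp (-(4 / 3) * m) := by ring
    _ ≤ u x t * Real.exp (-(4 / 3) * m) := by gcongr
    _ ≤ _ := h5

/-- If at `t = 0` one has `f ≤ g` and
`(min_ξ R(ξ,0))·(max_ξ g(ξ,0)²) > −3`, and `M̌(t)` tends to zero along some sequence of
times approaching the finite time `T`, then `M̌(t)² ≥ c (T − t)` for a uniform `c > 0`. -/
theorem neck_radius_lower_bound (T : ℝ) (f g ρ : ℝ → ℝ → ℝ)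
    (sol : WarpedBerger T f g ρ)
    (h_order : ∀ ξ : ℝ, f ξ 0 ≤ g ξ 0)
    (h_scal : (⨅ ξ : ℝ, scalR ρ f g ξ 0) * (⨆ ξ : ℝ, (g ξ 0) ^ 2) > -3)
    (hM : Filter.liminf (fun t => Mcheck f g t) (𝓝[<] T) = 0) :
    ∃ c : ℝ, 0 < c ∧ ∀ t : ℝ, 0 ≤ t → t < T → c * (T - t) ≤ (Mcheck f g t) ^ 2 := by
  have hT := sol.T_pos
  set I := Set.Ico 0 T with hI
  have uI : UniqueDiffOn ℝ I := uniqueDiffOn_Ico 0 T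
  have oI : IsOpen (Set.Ioo 0 T) := isOpen_Ioo
  have sub : Set.Ioo 0 T ⊆ I := Set.Ioo_subset_Ico_self
  have h0 : (0:ℝ) ∈ I := ⟨le_rfl, hT⟩
  have fp : ∀ x, ∀ t ∈ I, 0 < f x t := fun x t ht => sol.f_pos x t ht.1 ht.2
  have gp : ∀ x, ∀ t ∈ I, 0 < g x t := fun x t ht => sol.g_pos x t ht.1 ht.2
  have rp : ∀ x, ∀ t ∈ I, 0 < ρ x t := fun x t ht => sol.ρ_pos x t ht.1 ht.2
  have sf : Sm I f := sol.smooth.fst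
  have sg : Sm I g := sol.smooth.snd.fst
  have sr : Sm I ρ := sol.smooth.snd.snd
  set F : ℝ → ℝ → ℝ := fun x t => Real.log (f x t) with hF
  set G : ℝ → ℝ → ℝ := fun x t => Real.log (g x t) with hG
  have sF : Sm I F := sf.log fp
  have sG : Sm I G := sg.log gp
  have L1 : ∀ φ : ℝ → ℝ → ℝ, Sm I φ → (∀ x, ∀ t ∈ I, 0 < φ x t) → ∀ x, ∀ t ∈ I,
      Ds ρ φ x t = φ x t * Ds ρ (fun x t => Real.log (φ x t)) x t := by
    intro φ sφ pφ x t ht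
    have h2 : Ds ρ (fun x t => Real.log (φ x t)) x t = Ds ρ φ x t / φ x t := by
      apply Ds_of_has (rp x t ht)
      exact ((sφ.hasDs rp ht x).log (pφ x t ht).ne').congr_deriv (by ring)
    have := (pφ x t ht).ne'
    rw [h2]; field_simp
  have L2 : ∀ φ : ℝ → ℝ → ℝ, Sm I φ → (∀ x, ∀ t ∈ I, 0 < φ x t) → ∀ x, ∀ t ∈ I,
      Ds ρ (Ds ρ φ) x t = φ x t * (Ds ρ (Ds ρ (fun x t => Real.log (φ x t))) x t
        + Ds ρ (fun x t => Real.log (φ x t)) x t ^ 2) := by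
    intro φ sφ pφ x t ht
    apply Ds_of_has (rp x t ht)
    have h2 := (sφ.hasDs rp ht x).mul (((sφ.log pφ).Ds uI sr rp).hasDs rp ht x)
    rw [L1 φ sφ pφ x t ht] at h2
    refine (h2.congr_deriv ?_).congr_of_eventuallyEq
      (Eventually.of_forall fun y => L1 φ sφ pφ y t ht)
    ring
  have L3 : ∀ φ : ℝ → ℝ → ℝ, Sm I φ → (∀ x, ∀ t ∈ I, 0 < φ x t) → ∀ x, ∀ t ∈ Set.Ioo 0 T,
      pdt (fun x t => Real.log (φ x t)) x t = pdt φ x t / φ x t := by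
    intro φ sφ pφ x t ht
    exact (((sφ.mono sub).hasDerivT oI ht x).log (pφ x t (sub ht)).ne').deriv
  have eE : ∀ x, ∀ t ∈ I, Real.exp (2 * F x t - 4 * G x t) = f x t ^ 2 / g x t ^ 4 := by
    intro x t ht
    rw [Real.exp_sub]
    congr 1
    · rw [show 2 * F x t = F x t + F x t by ring, Real.exp_add, hF]
      simp only [Real.exp_log (fp x t ht)]; ring
    · rw [show 4 * G x t = G x t + G x t + G x t + G x t by ring, Real.exp_add, Real.exp_add,
        Real.exp_add, hG]
      simp only [Real.exp_log (gp x t ht)]; ring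
  have eE2 : ∀ φ : ℝ → ℝ → ℝ, (∀ x, ∀ t ∈ I, 0 < φ x t) → ∀ x, ∀ t ∈ I,
      Real.exp (2 * Real.log (φ x t)) = φ x t ^ 2 := by
    intro φ pφ x t ht
    rw [two_mul, Real.exp_add, Real.exp_log (pφ x t ht)]; ring
  have eH : ∀ x, ∀ t ∈ I, Real.exp (-2 * G x t) = 1 / g x t ^ 2 := by
    intro x t ht
    rw [neg_mul, Real.exp_neg, ← eE2 g gp x t ht, one_div]
  have eRL : ∀ x, ∀ t ∈ I, RL ρ F G x t = scalR ρ f g x t := by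
    intro x t ht
    have h1 := (fp x t ht).ne'
    have h2 := (gp x t ht).ne'
    unfold RL scalR k01 k02 k12 k23
    rw [eE x t ht, eH x t ht, L2 f sf fp x t ht, L2 g sg gp x t ht, L1 f sf fp x t ht,
      L1 g sg gp x t ht]
    simp only [← hF, ← hG]
    field_simp
    ring
  have pF : ∀ x t, F (x + 2 * π) t = F x t := fun x t => by simp only [hF, sol.f_per]
  have pG : ∀ x t, G (x + 2 * π) t = G x t := fun x t => by simp only [hG, sol.g_per]
  obtain ⟨C1, hC1⟩ := per_bdd (φ := fun x => scalR ρ f g x 0)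
    (fun x => by
      simp only [← eRL _ 0 h0]
      exact RL_per pF pG sol.ρ_per x 0)
    (by
      have := ((Sm.RL uI sF sG sr rp).slice h0).continuous
      refine this.congr (fun x => eRL x 0 h0))
  obtain ⟨C2, hC2⟩ := per_bdd (φ := fun x => g x 0 ^ 2)
    (fun x => by simp only [sol.g_per]) ((sg.slice h0).continuous.pow 2)
  have b1 : BddBelow (Set.range fun x => scalR ρ f g x 0) :=
    ⟨-C1, by rintro _ ⟨x, rfl⟩; exact (abs_le.mp (hC1 x)).1⟩
  have b2 : BddAbove (Set.range fun x => g x 0 ^ 2) :=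
    ⟨C2, by rintro _ ⟨x, rfl⟩; exact (abs_le.mp (hC2 x)).2⟩
  have hr := fun x => ciInf_le b1 x
  have hs := fun x => le_ciSup b2 x
  set r := ⨅ ξ : ℝ, scalR ρ f g ξ 0
  set s := ⨆ ξ : ℝ, (g ξ 0) ^ 2
  obtain ⟨c, hc, hmain⟩ := core T hT F G ρ sF sG sr rp pF pG sol.ρ_per
    (by
      intro x t ht
      have h1 := (fp x t (sub ht)).ne'
      have h2 := (gp x t (sub ht)).ne'
      rw [hF, L3 f sf fp x t ht, sol.eq_f x t ht.1 ht.2, L2 f sf fp x t (sub ht),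
        L1 f sf fp x t (sub ht), L1 g sg gp x t (sub ht), ← hF, eE x t (sub ht)]
      simp only [← hF, ← hG]
      field_simp)
    (by
      intro x t ht
      have h1 := (fp x t (sub ht)).ne'
      have h2 := (gp x t (sub ht)).ne'
      rw [hG, L3 g sg gp x t ht, sol.eq_g x t ht.1 ht.2, L2 g sg gp x t (sub ht),
        L1 f sf fp x t (sub ht), L1 g sg gp x t (sub ht), ← hG, eE x t (sub ht), eH x t (sub ht)]
      simp only [← hF, ← hG]
      field_simp
      ring)
    (by
      intro x t ht
      have h1 := (fp x t (sub ht)).ne'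
      have h2 := (gp x t (sub ht)).ne'
      rw [sol.eq_ρ x t ht.1 ht.2, L2 f sf fp x t (sub ht), L2 g sg gp x t (sub ht)]
      simp only [← hF, ← hG]
      field_simp
      ring)
    (fun x => Real.log_le_log (fp x 0 h0) (h_order x)) (min r 0) s (min_le_right _ _)
    (fun x => by rw [hG, eE2 g gp x 0 h0]; exact hs x)
    (fun x => by rw [eRL x 0 h0]; exact (min_le_left _ _).trans (hr x))
    (by
      rcases le_total r 0 with h | h
      · rw [min_eq_left h]; exact h_scal
      · rw [min_eq_right h]; norm_num)
  refine ⟨c, hc, fun t h1 h2 => ?_⟩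
  have ht : t ∈ I := ⟨h1, h2⟩
  have hle : Real.sqrt (c * (T - t)) ≤ Mcheck f g t := by
    refine le_ciInf fun x => ?_
    obtain ⟨k1, k2⟩ := hmain x t h1 h2
    have k3 : f x t ≤ g x t := (Real.log_le_log_iff (fp x t ht) (gp x t ht)).mp k2
    rw [hF, eE2 f fp x t ht] at k1
    have k4 : Real.sqrt (c * (T - t)) ≤ f x t := Real.sqrt_le_iff.mpr ⟨(fp x t ht).le, k1⟩
    exact le_min k4 (k4.trans k3)
  have hnn : 0 ≤ c * (T - t) := mul_nonneg hc.le (by linarith)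
  calc c * (T - t) = Real.sqrt (c * (T - t)) ^ 2 := (Real.sq_sqrt hnn).symm
    _ ≤ _ := pow_le_pow_left₀ (Real.sqrt_nonneg _) hle 2
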